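/- Under the even-case construction, the cost of the permutation algorithm's matching satisfies the exact identity C(π_A) = (k-1)(k+1)/2 - Σ_{i=1}^{k-1} (ε/8)·2^{i-k}. -/

import Mathlib

/-!
Even-case construction: k ≥ 2 even, 0 < ε ≤ 1.  Servers s_1,...,s_k at
positions 0,...,k-1 (s_i at position i-1).  ε_i = (ε/8)·2^(i-k) for i < k and
ε_k = 1/2.  Requests (1-indexed): for j = 1,...,k/2,
r_{2j-1} = (k/2 + j - 1) - 1/2 - ε_{2j-1},  r_{2j} = (k/2 - j) - 1/2 + ε_{2j}.
A matching is a function f : ℕ → ℕ sending each request index i ∈ {1,...,k} to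
a server index f i ∈ {1,...,k} (at position f i - 1); its cost is
C(f) = ∑_{i=1}^k |r_i - (f i - 1)|.
-/

/-- `ε_i`: equals `(ε/8)·2^(i-k)` for `i < k` and `1/2` for `i = k`. -/
noncomputable def eps (k : ℕ) (ε : ℝ) (i : ℕ) : ℝ :=
  if i = k then 1 / 2 else ε / 8 * (2 : ℝ) ^ ((i : ℤ) - (k : ℤ))

/-- The request `r_i` (1-indexed, `1 ≤ i ≤ k`): writing `i = 2j-1` or `i = 2j`,
`r_{2j-1} = (k/2 + j - 1) - 1/2 - ε_{2j-1}` and `r_{2j} = (k/2 - j) - 1/2 + ε_{2j}`. -/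
noncomputable def req (k : ℕ) (ε : ℝ) (i : ℕ) : ℝ :=
  if i % 2 = 1 then ((k : ℝ) / 2 + (((i + 1) / 2 : ℕ) : ℝ) - 1) - 1 / 2 - eps k ε i
  else ((k : ℝ) / 2 - ((i / 2 : ℕ) : ℝ)) - 1 / 2 + eps k ε i

/-- Cost of the matching sending request `i` to server `f i` (position `f i - 1`). -/
noncomputable def cost (k : ℕ) (ε : ℝ) (f : ℕ → ℕ) : ℝ :=
  ∑ i ∈ Finset.Icc 1 k, |req k ε i - ((f i : ℝ) - 1)|

/-- The permutation algorithm's matching `π_A`: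
`π_A(2j-1) = k/2 - j + 1`, `π_A(2j) = k/2 + j`. -/
def piA (k : ℕ) (i : ℕ) : ℕ :=
  if i % 2 = 1 then k / 2 - (i + 1) / 2 + 1 else k / 2 + i / 2

/-- The offline matching `π_B`: `π_B(2j-1) = k/2 + j`, `π_B(2j) = k/2 - j + 1`. -/
def piB (k : ℕ) (i : ℕ) : ℕ :=
  if i % 2 = 1 then k / 2 + (i + 1) / 2 else k / 2 - i / 2 + 1

theorem eps_le_half (k i : ℕ) (hi : i ≤ k) (ε : ℝ) (hε1 : ε ≤ 1) : eps k ε i ≤ 1 / 2 := by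
  unfold eps
  split_ifs
  · exact le_rfl
  · have h0 : (0 : ℝ) < (2 : ℝ) ^ ((i : ℤ) - (k : ℤ)) := by positivity
    have h1 : (2 : ℝ) ^ ((i : ℤ) - (k : ℤ)) ≤ 1 :=
      zpow_le_one_of_nonpos₀ (by norm_num) (by omega)
    nlinarith

theorem abs_req_sub_piA (k i : ℕ) (hke : Even k) (h1 : 1 ≤ i) (hi : i ≤ k)
    (ε : ℝ) (hε1 : ε ≤ 1) :
    |req k ε i - ((piA k i : ℝ) - 1)| = (i : ℝ) - 1 / 2 - eps k ε i := by
  have he := eps_le_half k i hi ε hε1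
  have h1' : (1 : ℝ) ≤ i := by exact_mod_cast h1
  obtain ⟨m, rfl⟩ := hke
  have hm : (m + m) / 2 = m := by omega
  unfold req piA
  rw [hm]
  rcases Nat.even_or_odd' i with ⟨j, rfl | rfl⟩
  · have hj : 2 * j / 2 = j := by omega
    rw [if_neg (by omega), if_neg (by omega), hj]
    push_cast at h1' ⊢
    rw [abs_of_nonpos] <;> linarith
  · have hj : (2 * j + 1 + 1) / 2 = j + 1 := by omega
    rw [if_pos (by omega), if_pos (by omega), hj]
    rw [Nat.cast_add (m - (j + 1)), Nat.cast_sub (by omega)]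
    push_cast at h1' ⊢
    rw [abs_of_nonneg] <;> linarith

theorem sum_Icc_sub_half (k : ℕ) :
    ∑ i ∈ Finset.Icc 1 k, ((i : ℝ) - 1 / 2) = (k : ℝ) ^ 2 / 2 := by
  induction k with
  | zero => simp
  | succ n ih =>
    rw [Finset.sum_Icc_succ_top (by omega), ih]
    push_cast
    ring

theorem sum_eps (k : ℕ) (hk : 1 ≤ k) (ε : ℝ) :
    ∑ i ∈ Finset.Icc 1 k, eps k ε i =
      ∑ i ∈ Finset.Icc 1 (k - 1), ε / 8 * (2 : ℝ) ^ ((i : ℤ) - (k : ℤ)) + 1 / 2 := by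
  obtain ⟨n, rfl⟩ := Nat.exists_eq_add_of_le' hk
  rw [Finset.sum_Icc_succ_top (by omega), Nat.add_sub_cancel]
  congr 1
  · refine Finset.sum_congr rfl fun i hi => ?_
    rw [Finset.mem_Icc] at hi
    exact if_neg (by omega)
  · exact if_pos rfl

/-- Even case: the exact identity C(π_A) = (k-1)(k+1)/2 - ∑_{i=1}^{k-1} (ε/8)·2^(i-k). -/
theorem even_permCost_eq (k : ℕ) (hk : 2 ≤ k) (hke : Even k)
    (ε : ℝ) (hε : 0 < ε) (hε1 : ε ≤ 1) :
    cost k ε (piA k) =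
      ((k : ℝ) - 1) * ((k : ℝ) + 1) / 2 -
        ∑ i ∈ Finset.Icc 1 (k - 1), ε / 8 * (2 : ℝ) ^ ((i : ℤ) - (k : ℤ)) := by
  have h : cost k ε (piA k) = ∑ i ∈ Finset.Icc 1 k, ((i : ℝ) - 1 / 2 - eps k ε i) :=
    Finset.sum_congr rfl fun i hi =>
      abs_req_sub_piA k i hke (Finset.mem_Icc.1 hi).1 (Finset.mem_Icc.1 hi).2 ε hε1
  rw [h, Finset.sum_sub_distrib, sum_Icc_sub_half, sum_eps k (by omega)]
  ring
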